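/- Asymptotic uniformity under the rate condition: with the setup of the multi-terminal leftover hash bound, if for every non-empty subset S of {1,…,T} the rates R_t = (1/n) log N_t satisfy Σ_{t∈S} R_t < H_{1+s}(A_S | E) for some fixed s ∈ (0,1], and the hashes act on n i.i.d. copies of the sources, then lim_{n→∞} (1/n) E_{X₁,…,X_T}[C_{1+s}(M₁,…,M_T | Eⁿ)] = 0. -/

import Mathlib

open Finset

/-- Conditional Shannon entropy `H(M|E)` of a joint pmf on `M × E`. -/
noncomputable def condShannon {M E : Type*} [Fintype M] [Fintype E] (p : M × E → ℝ) : ℝ :=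
  -∑ e, ∑ m, p (m, e) * Real.log (p (m, e) / ∑ m', p (m', e))

/-- Conditional Rényi entropy `H_{1+s}(M|E)` of a joint pmf on `M × E`
(Shannon entropy for `s = 0`). -/
noncomputable def condRenyi {M E : Type*} [Fintype M] [Fintype E] (s : ℝ)
    (p : M × E → ℝ) : ℝ :=
  if s = 0 then condShannon p
  else -(1 / s) * Real.log (∑ e, (∑ m', p (m', e)) *
    ∑ m, (p (m, e) / ∑ m', p (m', e)) ^ (1 + s))


/-- The sum inside the logarithm of the conditional Rényi entropy. -/
noncomputable def renyiPhi {M E : Type*} [Fintype M] [Fintype E] (s : ℝ)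
    (p : M × E → ℝ) : ℝ :=
  ∑ e, (∑ m', p (m', e)) * ∑ m, (p (m, e) / ∑ m', p (m', e)) ^ (1 + s)

lemma condRenyi_eq_phi {M E : Type*} [Fintype M] [Fintype E] (s : ℝ) (hs : 0 < s)
    (p : M × E → ℝ) : condRenyi s p = -(1 / s) * Real.log (renyiPhi s p) := by
  simp [condRenyi, renyiPhi, hs.ne']

lemma renyiPhi_eq {M E : Type*} [Fintype M] [Fintype E] (s : ℝ) (hs : 0 < s)
    (p : M × E → ℝ) (hp : ∀ x, 0 ≤ p x) :
    renyiPhi s p = ∑ e, ∑ m, p (m, e) * (p (m, e) / ∑ m', p (m', e)) ^ s := by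
  unfold renyiPhi
  refine Finset.sum_congr rfl fun e _ => ?_
  rw [Finset.mul_sum]
  refine Finset.sum_congr rfl fun m _ => ?_
  have h0 : 0 ≤ ∑ m', p (m', e) := Finset.sum_nonneg fun m _ => hp _
  rcases h0.eq_or_lt with h | h
  · have : p (m, e) = 0 :=
      (Finset.sum_eq_zero_iff_of_nonneg (fun m _ => hp (m, e))).1 h.symm m (Finset.mem_univ _)
    rw [← h, this]; simp
  · rw [Real.rpow_add_of_nonneg (div_nonneg (hp _) h0) zero_le_one hs.le, Real.rpow_one]
    field_simp

lemma one_le_renyiPhi {M E : Type*} [Fintype M] [Fintype E] (s : ℝ) (hs : 0 < s)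
    (p : M × E → ℝ) (hp : ∀ x, 0 ≤ p x) (h1 : ∑ x, p x = 1) :
    1 ≤ (Fintype.card M : ℝ) ^ s * renyiPhi s p := by
  unfold renyiPhi
  rw [Fintype.sum_prod_type_right] at h1
  rw [Finset.mul_sum]
  refine h1.symm.le.trans ?_
  refine Finset.sum_le_sum fun e _ => ?_
  have h0 : 0 ≤ ∑ m', p (m', e) := Finset.sum_nonneg fun m _ => hp _
  rcases h0.eq_or_lt with h | h
  · rw [← h]; simp
  · have key := Real.rpow_sum_le_const_mul_sum_rpow (p := 1 + s) Finset.univ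
      (fun m => p (m, e) / ∑ m', p (m', e)) (by linarith)
    simp only [abs_of_nonneg (div_nonneg (hp _) h0)] at key
    rw [← Finset.sum_div, div_self h.ne', Real.one_rpow] at key
    simp only [Finset.card_univ, add_sub_cancel_left] at key
    calc _ = (∑ m', p (m', e)) * 1 := by ring
      _ ≤ _ := mul_le_mul_of_nonneg_left key h0
      _ = _ := by ring

lemma push_sum {B M : Type*} [Fintype B] [Fintype M] (g : B → M)
    (r : B → M → Prop) [∀ b m, Decidable (r b m)] (hr : ∀ b m, r b m ↔ g b = m)
    (q : B → ℝ) (w : M → ℝ) :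
    ∑ m, (∑ b, if r b m then q b else 0) * w m = ∑ b, q b * w (g b) := by
  classical
  simp_rw [Finset.sum_mul]
  rw [Finset.sum_comm]
  refine Finset.sum_congr rfl fun b _ => ?_
  simp [hr, ite_mul]

lemma push_total {B M : Type*} [Fintype B] [Fintype M] (g : B → M)
    (r : B → M → Prop) [∀ b m, Decidable (r b m)] (hr : ∀ b m, r b m ↔ g b = m)
    (q : B → ℝ) :
    ∑ m, (∑ b, if r b m then q b else 0) = ∑ b, q b := by
  simpa using push_sum g r hr q (fun _ => 1)

lemma renyiPhi_push {B M E : Type*} [Fintype B] [Fintype M] [Fintype E] (s : ℝ) (hs : 0 < s)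
    (g : B → M) (r : B → M → Prop) [∀ b m, Decidable (r b m)] (hr : ∀ b m, r b m ↔ g b = m)
    (q : B × E → ℝ) (hq : ∀ x, 0 ≤ q x) :
    renyiPhi s (fun me : M × E => ∑ b, if r b me.1 then q (b, me.2) else 0) =
      ∑ e, ∑ b, q (b, e) *
        ((∑ b', if r b' (g b) then q (b', e) else 0) / ∑ b', q (b', e)) ^ s := by
  rw [renyiPhi_eq s hs _ (fun x => Finset.sum_nonneg fun b _ => by split_ifs <;> simp [hq])]
  refine Finset.sum_congr rfl fun e _ => ?_
  simp only [push_total g r hr (fun b => q (b, e))]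
  exact push_sum g r hr (fun b => q (b, e))
    (fun m => ((∑ b', if r b' m then q (b', e) else 0) / ∑ b', q (b', e)) ^ s)

lemma push_sum_one {B M E : Type*} [Fintype B] [Fintype M] [Fintype E]
    (g : B → M) (r : B → M → Prop) [∀ b m, Decidable (r b m)] (hr : ∀ b m, r b m ↔ g b = m)
    (q : B × E → ℝ) (h1 : ∑ x, q x = 1) :
    ∑ me : M × E, (∑ b, if r b me.1 then q (b, me.2) else 0) = 1 := by
  rw [Fintype.sum_prod_type_right] at h1 ⊢
  rw [← h1]
  exact Finset.sum_congr rfl fun e _ => push_total g r hr (fun b => q (b, e))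

lemma rpow_sum_le {ι : Type*} (S : Finset ι) (y : ι → ℝ) (hy : ∀ i, 0 ≤ y i) (s : ℝ)
    (hs : 0 < s) (hs1 : s ≤ 1) : (∑ i ∈ S, y i) ^ s ≤ ∑ i ∈ S, y i ^ s := by
  classical
  induction S using Finset.induction_on with
  | empty => simp [Real.zero_rpow hs.ne']
  | insert a S ha ih =>
    rw [Finset.sum_insert ha, Finset.sum_insert ha]
    exact (Real.rpow_add_le_add_rpow (hy a) (Finset.sum_nonneg fun i _ => hy i) hs.le hs1).trans
      (by gcongr)

lemma jensen_rpow {ι : Type*} [Fintype ι] (w y : ι → ℝ) (hw : ∀ i, 0 ≤ w i) (hw1 : ∑ i, w i = 1)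
    (hy : ∀ i, 0 ≤ y i) (s : ℝ) (hs : 0 < s) (hs1 : s ≤ 1) :
    ∑ i, w i * y i ^ s ≤ (∑ i, w i * y i) ^ s := by
  have := (Real.concaveOn_rpow hs.le hs1).le_map_sum (t := Finset.univ) (w := w) (p := y)
    (fun i _ => hw i) hw1 (fun i _ => hy i)
  simpa using this

lemma jensen_log {ι : Type*} [Fintype ι] (w y : ι → ℝ) (hw : ∀ i, 0 ≤ w i) (hw1 : ∑ i, w i = 1)
    (hy : ∀ i, 0 < y i) :
    ∑ i, w i * Real.log (y i) ≤ Real.log (∑ i, w i * y i) := by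
  have := (strictConcaveOn_log_Ioi.concaveOn).le_map_sum (t := Finset.univ) (w := w) (p := y)
    (fun i _ => hw i) hw1 (fun i _ => hy i)
  simpa using this

/-- marginal on the coordinates of `S`, evaluated at `b`. -/
noncomputable def margS {T : ℕ} {B : Fin T → Type*} [∀ t, Fintype (B t)]
    [∀ t, DecidableEq (B t)] {F : Type*} (q : (∀ t, B t) × F → ℝ) (S : Finset (Fin T))
    (b : ∀ t, B t) (e : F) : ℝ :=
  ∑ b' : ∀ t, B t, if ∀ t ∈ S, b' t = b t then q (b', e) else 0

/-- The quantity `exp (-s H_{1+s}(B_S|F))`. -/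
noncomputable def gS {T : ℕ} {B : Fin T → Type*} [∀ t, Fintype (B t)]
    [∀ t, DecidableEq (B t)] {F : Type*} [Fintype F] (s : ℝ)
    (q : (∀ t, B t) × F → ℝ) (S : Finset (Fin T)) : ℝ :=
  ∑ e, ∑ b, q (b, e) * (margS q S b e / ∑ b', q (b', e)) ^ s

lemma collision_bound {T : ℕ} {B : Fin T → Type*} [∀ t, Fintype (B t)]
    [∀ t, DecidableEq (B t)] {X : Fin T → Type*} [∀ t, Fintype (X t)]
    (N : Fin T → ℕ) (ε : ℝ) (hε : 0 < ε)
    (μ : ∀ t, X t → ℝ) (hμ0 : ∀ t x, 0 ≤ μ t x) (hμ1 : ∀ t, ∑ x, μ t x = 1)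
    (f : ∀ t, X t → B t → Fin (N t))
    (hAU : ∀ t, ∀ a₁ a₂ : B t, a₁ ≠ a₂ →
      ∑ x, μ t x * (if f t x a₁ = f t x a₂ then 1 else 0) ≤ ε / N t)
    (b b' : ∀ t, B t) :
    ∑ x : ∀ t, X t, (∏ t, μ t (x t)) *
        (if ∀ t, f t (x t) (b' t) = f t (x t) (b t) then 1 else 0) ≤
      ∑ S : Finset (Fin T), (if ∀ t ∈ S, b' t = b t then 1 else 0) * ∏ t ∈ (univ : Finset (Fin T)) \ S, (ε / N t) := by
  calc _ = ∑ x : ∀ t, X t, ∏ t, (μ t (x t) * (if f t (x t) (b' t) = f t (x t) (b t) then (1:ℝ) else 0)) := by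
        refine Finset.sum_congr rfl fun x _ => ?_
        rw [Finset.prod_mul_distrib, Finset.prod_ite_zero]; simp
    _ = ∏ t, ∑ x, (μ t x * (if f t x (b' t) = f t x (b t) then (1:ℝ) else 0)) := by
        rw [Finset.prod_univ_sum]; simp
    _ ≤ ∏ t, ((if b' t = b t then (1:ℝ) else 0) + ε / N t) := by
        refine Finset.prod_le_prod (fun t _ => Finset.sum_nonneg fun x _ =>
          mul_nonneg (hμ0 _ _) (by split_ifs <;> simp)) fun t _ => ?_
        by_cases h : b' t = b t
        · simp only [h, if_true, mul_one, hμ1]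
          have : 0 ≤ ε / N t := by positivity
          linarith
        · simpa [h] using hAU t _ _ h
    _ = _ := by
        rw [Finset.prod_add, Finset.powerset_univ]
        refine Finset.sum_congr rfl fun S _ => ?_
        rw [Finset.prod_ite_zero]; simp

lemma one_shot {T : ℕ} {B : Fin T → Type*} [∀ t, Fintype (B t)]
    [∀ t, DecidableEq (B t)] {F : Type*} [Fintype F] {X : Fin T → Type*} [∀ t, Fintype (X t)]
    (N : Fin T → ℕ) (ε : ℝ) (hε : 0 < ε)
    (μ : ∀ t, X t → ℝ) (hμ0 : ∀ t x, 0 ≤ μ t x) (hμ1 : ∀ t, ∑ x, μ t x = 1)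
    (f : ∀ t, X t → B t → Fin (N t))
    (hAU : ∀ t, ∀ a₁ a₂ : B t, a₁ ≠ a₂ →
      ∑ x, μ t x * (if f t x a₁ = f t x a₂ then 1 else 0) ≤ ε / N t)
    (q : (∀ t, B t) × F → ℝ) (hq : ∀ x, 0 ≤ q x) (s : ℝ) (hs : 0 < s) (hs1 : s ≤ 1) :
    ∑ x : ∀ t, X t, (∏ t, μ t (x t)) *
      renyiPhi s (fun me : (∀ t, Fin (N t)) × F => ∑ b : ∀ t, B t,
        if (∀ t, f t (x t) (b t) = me.1 t) then q (b, me.2) else 0) ≤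
    ∑ S : Finset (Fin T), (∏ t ∈ (univ : Finset (Fin T)) \ S, (ε / N t)) ^ s * gS s q S := by
  have hw1 : ∑ x : ∀ t, X t, (∏ t, μ t (x t)) = 1 := by
    have := Finset.prod_univ_sum (fun t => (univ : Finset (X t))) μ
    simp [hμ1] at this
    exact this.symm
  have hw0 : ∀ x : ∀ t, X t, 0 ≤ ∏ t, μ t (x t) := fun x => Finset.prod_nonneg fun t _ => hμ0 _ _
  have hc0 : ∀ S : Finset (Fin T), 0 ≤ ∏ t ∈ (univ : Finset (Fin T)) \ S, (ε / N t) :=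
    fun S => Finset.prod_nonneg fun t _ => by positivity
  have hE0 : ∀ e, 0 ≤ ∑ b', q (b', e) := fun e => Finset.sum_nonneg fun b _ => hq _
  have hm0 : ∀ S b e, 0 ≤ margS q S b e := fun S b e =>
    Finset.sum_nonneg fun b _ => by split_ifs <;> simp [hq]
  have hphi : ∀ x : ∀ t, X t, renyiPhi s (fun me : (∀ t, Fin (N t)) × F => ∑ b : ∀ t, B t,
        if (∀ t, f t (x t) (b t) = me.1 t) then q (b, me.2) else 0) =
      ∑ e, ∑ b, q (b, e) * ((∑ b' : ∀ t, B t,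
        if (∀ t, f t (x t) (b' t) = f t (x t) (b t)) then q (b', e) else 0) / ∑ b', q (b', e)) ^ s :=
    fun x => renyiPhi_push s hs (fun (b : ∀ t, B t) t => f t (x t) (b t))
      (fun b m => ∀ t, f t (x t) (b t) = m t) (fun b m => funext_iff.symm) q hq
  simp_rw [hphi, gS, Finset.mul_sum]
  rw [Finset.sum_comm]
  conv_rhs => rw [Finset.sum_comm]
  refine Finset.sum_le_sum fun e _ => ?_
  rw [Finset.sum_comm]
  conv_rhs => rw [Finset.sum_comm]
  refine Finset.sum_le_sum fun b _ => ?_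
  have e1 : ∑ x : ∀ t, X t, (∏ t, μ t (x t)) * (q (b, e) * ((∑ b' : ∀ t, B t,
        if (∀ t, f t (x t) (b' t) = f t (x t) (b t)) then q (b', e) else 0) / ∑ b', q (b', e)) ^ s)
      = q (b, e) * ∑ x : ∀ t, X t, (∏ t, μ t (x t)) * ((∑ b' : ∀ t, B t,
        if (∀ t, f t (x t) (b' t) = f t (x t) (b t)) then q (b', e) else 0) / ∑ b', q (b', e)) ^ s := by
    rw [Finset.mul_sum]; exact Finset.sum_congr rfl fun _ _ => by ring
  have e2 : ∑ S : Finset (Fin T), (∏ t ∈ (univ : Finset (Fin T)) \ S, (ε / N t)) ^ s *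
        (q (b, e) * (margS q S b e / ∑ b', q (b', e)) ^ s) =
      q (b, e) * ∑ S : Finset (Fin T), ((∏ t ∈ (univ : Finset (Fin T)) \ S, (ε / N t)) *
        (margS q S b e / ∑ b', q (b', e))) ^ s := by
    rw [Finset.mul_sum]
    refine Finset.sum_congr rfl fun S _ => ?_
    rw [Real.mul_rpow (hc0 S) (div_nonneg (hm0 _ _ _) (hE0 e))]; ring
  rw [e1, e2]
  refine mul_le_mul_of_nonneg_left ?_ (hq _)
  have hy0 : ∀ x : ∀ t, X t, 0 ≤ ∑ b' : ∀ t, B t,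
      if (∀ t, f t (x t) (b' t) = f t (x t) (b t)) then q (b', e) else 0 := fun x =>
    Finset.sum_nonneg fun b _ => by split_ifs <;> simp [hq]
  refine (jensen_rpow _ _ hw0 hw1 (fun x => div_nonneg (hy0 x) (hE0 e)) s hs hs1).trans ?_
  refine le_trans ?_ (rpow_sum_le _ _
    (fun S => mul_nonneg (hc0 S) (div_nonneg (hm0 S b e) (hE0 e))) s hs hs1)
  refine Real.rpow_le_rpow (Finset.sum_nonneg fun x _ =>
    mul_nonneg (hw0 x) (div_nonneg (hy0 x) (hE0 e))) ?_ hs.le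
  simp_rw [← mul_div_assoc]
  rw [← Finset.sum_div, ← Finset.sum_div]
  refine div_le_div_of_nonneg_right ?_ (hE0 e)
  calc _ = ∑ b', q (b', e) * ∑ x : ∀ t, X t, (∏ t, μ t (x t)) *
        (if ∀ t, f t (x t) (b' t) = f t (x t) (b t) then 1 else 0) := by
        simp_rw [Finset.mul_sum]
        rw [Finset.sum_comm]
        refine Finset.sum_congr rfl fun _ _ => Finset.sum_congr rfl fun _ _ => ?_
        split_ifs <;> ring
    _ ≤ ∑ b', q (b', e) * ∑ S : Finset (Fin T), (if ∀ t ∈ S, b' t = b t then 1 else 0) *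
        ∏ t ∈ (univ : Finset (Fin T)) \ S, (ε / N t) :=
        Finset.sum_le_sum fun b' _ => mul_le_mul_of_nonneg_left
          (collision_bound N ε hε μ hμ0 hμ1 f hAU b b') (hq _)
    _ = _ := by
        simp_rw [margS, Finset.mul_sum]
        rw [Finset.sum_comm]
        refine Finset.sum_congr rfl fun _ _ => Finset.sum_congr rfl fun _ _ => ?_
        split_ifs <;> ring

lemma sum_reindex {T n : ℕ} {A : Fin T → Type*} [∀ t, Fintype (A t)]
    (g : (Fin n → ∀ t, A t) → ℝ) :
    ∑ b : ∀ t, Fin n → A t, g (fun i t => b t i) = ∑ c, g c :=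
  Fintype.sum_equiv (Equiv.piComm (fun (t : Fin T) (_ : Fin n) => A t)) _ _ (fun _ => rfl)

/-- The n-fold product law. -/
noncomputable def iidP {T : ℕ} {A : Fin T → Type*} {E : Type*} (n : ℕ)
    (P : (∀ t, A t) × E → ℝ) : (∀ t, Fin n → A t) × (Fin n → E) → ℝ :=
  fun q => ∏ i, P (fun t => q.1 t i, q.2 i)

lemma margS_iid {T n : ℕ} {A : Fin T → Type*} [∀ t, Fintype (A t)] [∀ t, DecidableEq (A t)]
    {E : Type*} (P : (∀ t, A t) × E → ℝ) (S : Finset (Fin T))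
    (b : ∀ t, Fin n → A t) (e : Fin n → E) :
    margS (iidP n P) S b e = ∏ i, margS P S (fun t => b t i) (e i) := by
  unfold margS iidP
  rw [Finset.prod_univ_sum]
  simp only [Fintype.piFinset_univ]
  rw [← sum_reindex]
  refine Finset.sum_congr rfl fun c _ => ?_
  rw [Finset.prod_ite_zero]
  have hiff : (∀ t ∈ S, c t = b t) ↔ ∀ i ∈ (univ : Finset (Fin n)), ∀ t ∈ S, c t i = b t i :=
    ⟨fun h i _ t ht => by rw [h t ht], fun h t ht => funext fun i => h i (Finset.mem_univ _) t ht⟩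
  by_cases h : ∀ t ∈ S, c t = b t
  · rw [if_pos h, if_pos (hiff.1 h)]
  · rw [if_neg h, if_neg (fun h' => h (hiff.2 h'))]

lemma total_iid {T n : ℕ} {A : Fin T → Type*} [∀ t, Fintype (A t)] 
    {E : Type*} (P : (∀ t, A t) × E → ℝ) (e : Fin n → E) :
    ∑ b, iidP n P (b, e) = ∏ i, ∑ a, P (a, e i) := by
  unfold iidP
  rw [Finset.prod_univ_sum]
  simp only [Fintype.piFinset_univ]
  rw [← sum_reindex]

lemma iid_pow {T n : ℕ} {A : Fin T → Type*} [∀ t, Fintype (A t)]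
    {E : Type*} [Fintype E] (g : (∀ t, A t) → E → ℝ) :
    ∑ e : Fin n → E, ∑ b : ∀ t, Fin n → A t, ∏ i, g (fun t => b t i) (e i) =
      (∑ e, ∑ a, g a e) ^ n := by
  rw [Fintype.sum_pow]
  refine Finset.sum_congr rfl fun e _ => ?_
  rw [Finset.prod_univ_sum]
  simp only [Fintype.piFinset_univ]
  rw [← sum_reindex]

lemma gS_iid {T n : ℕ} {A : Fin T → Type*} [∀ t, Fintype (A t)] [∀ t, DecidableEq (A t)]
    {E : Type*} [Fintype E] (P : (∀ t, A t) × E → ℝ) (hP : ∀ x, 0 ≤ P x) (s : ℝ)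
    (S : Finset (Fin T)) : gS s (iidP n P) S = gS s P S ^ n := by
  have hm0 : ∀ b e, 0 ≤ margS P S b e := fun b e =>
    Finset.sum_nonneg fun b _ => by split_ifs <;> simp [hP]
  unfold gS
  rw [← iid_pow]
  refine Finset.sum_congr rfl fun e _ => Finset.sum_congr rfl fun b _ => ?_
  rw [margS_iid, total_iid, ← Finset.prod_div_distrib, Finset.prod_mul_distrib,
    Real.finsetProd_rpow]
  · rfl
  · exact fun i _ => div_nonneg (hm0 _ _) (Finset.sum_nonneg fun _ _ => hP _)

lemma gS_empty {T : ℕ} {A : Fin T → Type*} [∀ t, Fintype (A t)] [∀ t, DecidableEq (A t)]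
    {E : Type*} [Fintype E] (P : (∀ t, A t) × E → ℝ) (hP : ∀ x, 0 ≤ P x)
    (h1 : ∑ x, P x = 1) (s : ℝ) : gS s P ∅ = 1 := by
  unfold gS margS
  rw [Fintype.sum_prod_type_right] at h1
  rw [← h1]
  refine Finset.sum_congr rfl fun e _ => Finset.sum_congr rfl fun b _ => ?_
  have h0 : 0 ≤ ∑ m', P (m', e) := Finset.sum_nonneg fun m _ => hP _
  rcases h0.eq_or_lt with h | h
  · have : P (b, e) = 0 :=
      (Finset.sum_eq_zero_iff_of_nonneg (fun m _ => hP (m, e))).1 h.symm b (Finset.mem_univ _)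
    rw [this]; simp
  · simp [div_self h.ne']

lemma gS_eq_phi {T : ℕ} {A : Fin T → Type*} [∀ t, Fintype (A t)] [∀ t, DecidableEq (A t)]
    {E : Type*} [Fintype E] (P : (∀ t, A t) × E → ℝ) (hP : ∀ x, 0 ≤ P x)
    (s : ℝ) (hs : 0 < s) (S : Finset (Fin T)) :
    renyiPhi s (fun ae : (∀ t : {t // t ∈ S}, A t.1) × E =>
        ∑ a : ∀ t, A t,
          if (∀ t : {t // t ∈ S}, a t.1 = ae.1 t) then P (a, ae.2) else 0) = gS s P S := by
  rw [renyiPhi_push s hs (fun (a : ∀ t, A t) (t : {t // t ∈ S}) => a t.1)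
    (fun a c => ∀ t : {t // t ∈ S}, a t.1 = c t) (fun _ _ => funext_iff.symm) P hP]
  unfold gS margS
  simp only [Subtype.forall]

lemma gS_bound {T : ℕ} {A : Fin T → Type*} [∀ t, Fintype (A t)] [∀ t, DecidableEq (A t)]
    {E : Type*} [Fintype E] (P : (∀ t, A t) × E → ℝ) (hP : ∀ x, 0 ≤ P x) (h1 : ∑ x, P x = 1)
    (s : ℝ) (hs : 0 < s) (S : Finset (Fin T)) (r : ℝ)
    (hr : r < condRenyi s (fun ae : (∀ t : {t // t ∈ S}, A t.1) × E =>
        ∑ a : ∀ t, A t,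
          if (∀ t : {t // t ∈ S}, a t.1 = ae.1 t) then P (a, ae.2) else 0)) :
    0 ≤ gS s P S ∧ Real.exp (s * r) * gS s P S ≤ 1 := by
  have hpos := one_le_renyiPhi s hs (fun ae : (∀ t : {t // t ∈ S}, A t.1) × E =>
        ∑ a : ∀ t, A t,
          if (∀ t : {t // t ∈ S}, a t.1 = ae.1 t) then P (a, ae.2) else 0)
    (fun x => Finset.sum_nonneg fun b _ => by split_ifs <;> simp [hP])
    (push_sum_one (fun (a : ∀ t, A t) (t : {t // t ∈ S}) => a t.1)
    (fun a c => ∀ t : {t // t ∈ S}, a t.1 = c t) (fun _ _ => funext_iff.symm) P h1)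
  rw [condRenyi_eq_phi s hs, gS_eq_phi P hP s hs S] at hr
  rw [gS_eq_phi P hP s hs] at hpos
  have hg : 0 < gS s P S := by
    by_contra hneg
    have := mul_nonpos_of_nonneg_of_nonpos
      (Real.rpow_nonneg (Nat.cast_nonneg (α := ℝ) (Fintype.card (∀ t : {t // t ∈ S}, A t.1))) s)
      (not_lt.1 hneg)
    linarith
  refine ⟨hg.le, ?_⟩
  have h4 : Real.exp (s * r) * gS s P S = Real.exp (s * r + Real.log (gS s P S)) := by
    rw [Real.exp_add, Real.exp_log hg]
  rw [h4]
  apply Real.exp_le_one_iff.2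
  have h2 := mul_lt_mul_of_pos_left hr hs
  have h3 : s * (-(1 / s) * Real.log (gS s P S)) = - Real.log (gS s P S) := by field_simp
  linarith

lemma coef_bound {T n : ℕ} {A : Fin T → Type*} [∀ t, Fintype (A t)] [∀ t, DecidableEq (A t)]
    {E : Type*} [Fintype E] (N : Fin T → ℕ) (hN : ∀ t, 0 < N t)
    (R : Fin T → ℝ) (hR : ∀ t, Real.log (N t) = n * R t) (ε : ℝ) (hε : 0 < ε)
    (P : (∀ t, A t) × E → ℝ) (s : ℝ) (S : Finset (Fin T))
    (hg : 0 ≤ gS s P S) (hb : Real.exp (s * ∑ t ∈ S, R t) * gS s P S ≤ 1) :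
    (∏ t, (N t : ℝ)) ^ s * ((∏ t ∈ (univ : Finset (Fin T)) \ S, (ε / N t)) ^ s * gS s P S ^ n) ≤
      (∏ _t ∈ (univ : Finset (Fin T)) \ S, ε) ^ s := by
  have hN' : ∀ t, (0 : ℝ) < N t := fun t => Nat.cast_pos.2 (hN t)
  have hexp : ∏ t ∈ S, (N t : ℝ) = Real.exp (n * ∑ t ∈ S, R t) := by
    rw [Finset.mul_sum, Real.exp_sum]
    exact Finset.prod_congr rfl fun t _ => by rw [← hR, Real.exp_log (hN' t)]
  have hsplit : (∏ t, (N t : ℝ)) * ∏ t ∈ (univ : Finset (Fin T)) \ S, (ε / N t) =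
      (∏ _t ∈ (univ : Finset (Fin T)) \ S, ε) * Real.exp (n * ∑ t ∈ S, R t) := by
    rw [← hexp, ← Finset.prod_sdiff (Finset.subset_univ S), Finset.prod_div_distrib]
    have : ∏ t ∈ (univ : Finset (Fin T)) \ S, (N t : ℝ) ≠ 0 :=
      Finset.prod_ne_zero_iff.2 fun t _ => (hN' t).ne'
    field_simp
  have h0 : 0 ≤ ∏ _t ∈ (univ : Finset (Fin T)) \ S, ε := Finset.prod_nonneg fun _ _ => hε.le
  rw [← mul_assoc, ← Real.mul_rpow (Finset.prod_nonneg fun t _ => (hN' t).le)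
    (Finset.prod_nonneg fun t _ => (div_pos hε (hN' t)).le), hsplit,
    Real.mul_rpow h0 (Real.exp_pos _).le, mul_assoc]
  refine mul_le_of_le_one_right (Real.rpow_nonneg h0 s) ?_
  have : Real.exp (n * ∑ t ∈ S, R t) ^ s = Real.exp (s * ∑ t ∈ S, R t) ^ n := by
    rw [← Real.exp_mul, ← Real.exp_nat_mul]; congr 1; ring
  rw [this, ← mul_pow]
  exact pow_le_one₀ (mul_nonneg (Real.exp_pos _).le hg) hb

/-- Asymptotic uniformity under the rate condition: if for every non-empty
`S ⊆ [T]` the rates satisfy `Σ_{t∈S} R_t < H_{1+s}(A_S|E)`, then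
`(1/n)·E_{X_{1:T}}[C_{1+s}(M_{1:T}|Eⁿ)] → 0`. -/
theorem asymptotic_uniformity {T : ℕ} {A : Fin T → Type*}
    [∀ t, Fintype (A t)] [∀ t, DecidableEq (A t)]
    {E : Type*} [Fintype E]
    {X : Fin T → ℕ → Type*} [∀ t n, Fintype (X t n)]
    (N : Fin T → ℕ → ℕ) (hNpos : ∀ t n, 0 < N t n)
    (R : Fin T → ℝ) (hR : ∀ t n, Real.log (N t n) = n * R t)
    (ε : ℝ) (hε : 0 < ε)
    (P : (∀ t, A t) × E → ℝ) (hP0 : ∀ p, 0 ≤ P p) (hP1 : ∑ p, P p = 1)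
    (μ : ∀ t n, X t n → ℝ) (hμ0 : ∀ t n x, 0 ≤ μ t n x) (hμ1 : ∀ t n, ∑ x, μ t n x = 1)
    (f : ∀ t n, X t n → (Fin n → A t) → Fin (N t n))
    (hAU : ∀ t n, ∀ a₁ a₂ : Fin n → A t, a₁ ≠ a₂ →
      ∑ x, μ t n x * (if f t n x a₁ = f t n x a₂ then 1 else 0) ≤ ε / N t n)
    (s : ℝ) (hs0 : 0 < s) (hs1 : s ≤ 1)
    (hrate : ∀ S : Finset (Fin T), S.Nonempty →
      ∑ t ∈ S, R t < condRenyi s (fun ae : (∀ t : {t // t ∈ S}, A t.1) × E =>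
        ∑ a : ∀ t, A t,
          if (∀ t : {t // t ∈ S}, a t.1 = ae.1 t) then P (a, ae.2) else 0)) :
    Filter.Tendsto (fun n : ℕ =>
        (1 / (n : ℝ)) * ∑ x : ∀ t, X t n, (∏ t, μ t n (x t)) *
          ((∑ t, Real.log (N t n)) -
            condRenyi s (fun me : (∀ t, Fin (N t n)) × (Fin n → E) =>
              ∑ a : ∀ t, Fin n → A t,
                if (∀ t, f t n (x t) (a t) = me.1 t) then
                  ∏ i, P (fun t => a t i, me.2 i) else 0)))
      Filter.atTop (nhds 0) := by

  classical
  set K : ℝ := ∑ S : Finset (Fin T), (∏ _t ∈ (univ : Finset (Fin T)) \ S, ε) ^ s with hK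
  suffices hmain : ∀ n : ℕ,
      0 ≤ ∑ x : ∀ t, X t n, (∏ t, μ t n (x t)) *
          ((∑ t, Real.log (N t n)) -
            condRenyi s (fun me : (∀ t, Fin (N t n)) × (Fin n → E) =>
              ∑ a : ∀ t, Fin n → A t,
                if (∀ t, f t n (x t) (a t) = me.1 t) then
                  ∏ i, P (fun t => a t i, me.2 i) else 0)) ∧
      ∑ x : ∀ t, X t n, (∏ t, μ t n (x t)) *
          ((∑ t, Real.log (N t n)) -
            condRenyi s (fun me : (∀ t, Fin (N t n)) × (Fin n → E) =>
              ∑ a : ∀ t, Fin n → A t,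
                if (∀ t, f t n (x t) (a t) = me.1 t) then
                  ∏ i, P (fun t => a t i, me.2 i) else 0)) ≤ 1 / s * Real.log K by
    have hlim : Filter.Tendsto (fun n : ℕ => (1 / (n : ℝ)) * (1 / s * Real.log K))
        Filter.atTop (nhds 0) := by
      simpa using (tendsto_one_div_atTop_nhds_zero_nat (𝕜 := ℝ)).mul_const (1 / s * Real.log K)
    refine squeeze_zero (fun n => mul_nonneg (by positivity) (hmain n).1) (fun n => ?_) hlim
    exact mul_le_mul_of_nonneg_left (hmain n).2 (by positivity)
  intro n
  have hN' : ∀ t, (0 : ℝ) < N t n := fun t => Nat.cast_pos.2 (hNpos t n)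
  have hw1 : ∑ x : ∀ t, X t n, (∏ t, μ t n (x t)) = 1 := by
    have := Finset.prod_univ_sum (fun t => (univ : Finset (X t n))) (fun t => μ t n)
    simp [hμ1] at this
    exact this.symm
  have hw0 : ∀ x : ∀ t, X t n, 0 ≤ ∏ t, μ t n (x t) :=
    fun x => Finset.prod_nonneg fun t _ => hμ0 _ _ _
  have hq0 : ∀ x, 0 ≤ iidP n P x := fun x => Finset.prod_nonneg fun i _ => hP0 _
  have hq1 : ∑ x, iidP n P x = 1 := by
    rw [Fintype.sum_prod_type_right] at hP1 ⊢
    have := iid_pow (n := n) (fun a e => P (a, e))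
    rw [hP1, one_pow] at this
    exact this
  set Φ : (∀ t, X t n) → ℝ := fun x =>
    renyiPhi s (fun me : (∀ t, Fin (N t n)) × (Fin n → E) =>
              ∑ a : ∀ t, Fin n → A t,
                if (∀ t, f t n (x t) (a t) = me.1 t) then iidP n P (a, me.2) else 0) with hΦ
  have hcond : ∀ x : ∀ t, X t n, condRenyi s (fun me : (∀ t, Fin (N t n)) × (Fin n → E) =>
              ∑ a : ∀ t, Fin n → A t,
                if (∀ t, f t n (x t) (a t) = me.1 t) then
                  ∏ i, P (fun t => a t i, me.2 i) else 0) = -(1 / s) * Real.log (Φ x) :=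
    fun x => condRenyi_eq_phi s hs0 _
  simp only [hcond]
  set Q : ℝ := ∏ t, (N t n : ℝ) with hQ
  have hQ0 : 0 < Q := Finset.prod_pos fun t _ => hN' t
  have hQs : 0 < Q ^ s := Real.rpow_pos_of_pos hQ0 s
  have hlogQ : ∑ t, Real.log (N t n) = Real.log Q := by
    rw [hQ, Real.log_prod fun t _ => (hN' t).ne']
  have hone : ∀ x, 1 ≤ Q ^ s * Φ x := by
    intro x
    have := one_le_renyiPhi s hs0 (fun me : (∀ t, Fin (N t n)) × (Fin n → E) =>
              ∑ a : ∀ t, Fin n → A t,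
                if (∀ t, f t n (x t) (a t) = me.1 t) then iidP n P (a, me.2) else 0)
      (fun x => Finset.sum_nonneg fun b _ => by split_ifs <;> simp [hq0])
      (push_sum_one (fun (b : ∀ t, Fin n → A t) t => f t n (x t) (b t))
      (fun b m => ∀ t, f t n (x t) (b t) = m t) (fun b m => funext_iff.symm) (iidP n P) hq1)
    simpa [Fintype.card_pi, hQ] using this
  have hΦ0 : ∀ x, 0 < Φ x := fun x => by
    by_contra hneg
    have := mul_nonpos_of_nonneg_of_nonpos hQs.le (not_lt.1 hneg)
    linarith [hone x]
  have hC : ∀ x, (∑ t, Real.log (N t n)) - -(1 / s) * Real.log (Φ x) =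
      1 / s * Real.log (Q ^ s * Φ x) := by
    intro x
    rw [hlogQ, Real.log_mul hQs.ne' (hΦ0 x).ne', Real.log_rpow hQ0]
    field_simp
    ring
  simp only [hC]
  refine ⟨Finset.sum_nonneg fun x _ => mul_nonneg (hw0 x)
    (mul_nonneg (by positivity) (Real.log_nonneg (hone x))), ?_⟩
  have hswap : ∑ x : ∀ t, X t n, (∏ t, μ t n (x t)) * (1 / s * Real.log (Q ^ s * Φ x)) =
      1 / s * ∑ x : ∀ t, X t n, (∏ t, μ t n (x t)) * Real.log (Q ^ s * Φ x) := by
    rw [Finset.mul_sum]; exact Finset.sum_congr rfl fun _ _ => by ring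
  rw [hswap]
  refine mul_le_mul_of_nonneg_left ?_ (by positivity)
  refine (jensen_log _ _ hw0 hw1 (fun x => mul_pos hQs (hΦ0 x))).trans ?_
  have hge1 : 1 ≤ ∑ x : ∀ t, X t n, (∏ t, μ t n (x t)) * (Q ^ s * Φ x) := by
    rw [← hw1]
    exact Finset.sum_le_sum fun x _ => le_mul_of_one_le_right (hw0 x) (hone x)
  refine Real.log_le_log (by linarith) ?_
  have hos := one_shot (fun t => N t n) ε hε (fun t => μ t n) (fun t => hμ0 t n)
    (fun t => hμ1 t n) (fun t => f t n) (fun t => hAU t n) (iidP n P) hq0 s hs0 hs1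
  calc _ = Q ^ s * ∑ x : ∀ t, X t n, (∏ t, μ t n (x t)) * Φ x := by
        rw [Finset.mul_sum]; exact Finset.sum_congr rfl fun _ _ => by ring
    _ ≤ Q ^ s * ∑ S : Finset (Fin T),
        (∏ t ∈ (univ : Finset (Fin T)) \ S, (ε / N t n)) ^ s * gS s (iidP n P) S :=
        mul_le_mul_of_nonneg_left hos hQs.le
    _ ≤ K := by
        rw [Finset.mul_sum, hK]
        refine Finset.sum_le_sum fun S _ => ?_
        rw [gS_iid P hP0 s S]
        have hb : 0 ≤ gS s P S ∧ Real.exp (s * ∑ t ∈ S, R t) * gS s P S ≤ 1 := by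
          rcases S.eq_empty_or_nonempty with rfl | hS
          · rw [gS_empty P hP0 hP1 s]; simp
          · exact gS_bound P hP0 hP1 s hs0 S _ (hrate S hS)
        exact coef_bound (fun t => N t n) (fun t => hNpos t n) R (fun t => hR t n) ε hε P s S
          hb.1 hb.2
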